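/- Fix an integer i with 1 < i < L, real scalars φ_1, φ_2, φ_3, a matrix Ψ' ∈ ℝ^{n_0 × n_L}, and a row vector Ψ ∈ ℝ^{1 × n_L}. Define E(U) := φ_1 · W^(i) + φ_2 · [W]^(i,0) · Ψ' · [W]^(L,i−1) + φ_3 · b^(i) · Ψ · [W]^(L,i−1) ∈ ℝ^{n_i × n_{i−1}}, where b^(i) is viewed as an n_i × 1 column matrix. Then E is G-equivariant at layer i: for every g ∈ G and every weight-space element U, E(gU) = g^(i) · E(U) · (g^(i−1))^{−1}. -/

import Mathlib

open Matrix

noncomputable section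

/-- The product `[W]^(s,t) = W^(s) * W^(s-1) * ⋯ * W^(t+1)` of `s - t` weight matrices. -/
def Wprod (n : ℕ → ℕ) (W : ∀ i : ℕ, Matrix (Fin (n i)) (Fin (n (i - 1))) ℝ) :
    (s : ℕ) → (t : ℕ) → Matrix (Fin (n s)) (Fin (n t)) ℝ
  | s, t =>
    if _h : t < s then W s * Wprod n W (s - 1) t
    else Matrix.of fun i j => if (i : ℕ) = (j : ℕ) then (1 : ℝ) else 0
termination_by s t => s
decreasing_by omega

/-- The group `G`: tuples `g = (g^(L), …, g^(0))` of invertible matrices with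
`g^(L) = I`, `g^(0) = I`, and `g^(i)` a product of a positive diagonal matrix and a
permutation matrix for `0 < i < L`. -/
def IsInG (L : ℕ) (n : ℕ → ℕ) (g : ∀ i : ℕ, GL (Fin (n i)) ℝ) : Prop :=
  ((g L : Matrix (Fin (n L)) (Fin (n L)) ℝ) = 1) ∧
  ((g 0 : Matrix (Fin (n 0)) (Fin (n 0)) ℝ) = 1) ∧
  ∀ i : ℕ, 0 < i → i < L →
    ∃ (d : Fin (n i) → ℝ) (π : Equiv.Perm (Fin (n i))),
      (∀ j, 0 < d j) ∧
      (g i : Matrix (Fin (n i)) (Fin (n i)) ℝ) = Matrix.diagonal d * π.permMatrix ℝ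

/-- The action of `g` on the weights: `[gW]^(i) = g^(i) · W^(i) · (g^(i-1))⁻¹`. -/
def actW (n : ℕ → ℕ) (g : ∀ i : ℕ, GL (Fin (n i)) ℝ)
    (W : ∀ i : ℕ, Matrix (Fin (n i)) (Fin (n (i - 1))) ℝ) (i : ℕ) :
    Matrix (Fin (n i)) (Fin (n (i - 1))) ℝ :=
  (g i : Matrix (Fin (n i)) (Fin (n i)) ℝ) * W i *
    (((g (i - 1))⁻¹ : GL (Fin (n (i - 1))) ℝ) : Matrix (Fin (n (i - 1))) (Fin (n (i - 1))) ℝ)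

/-- The action of `g` on the biases: `[gb]^(i) = g^(i) · b^(i)`. -/
def actb (n : ℕ → ℕ) (g : ∀ i : ℕ, GL (Fin (n i)) ℝ)
    (b : ∀ i : ℕ, Matrix (Fin (n i)) (Fin 1) ℝ) (i : ℕ) : Matrix (Fin (n i)) (Fin 1) ℝ :=
  (g i : Matrix (Fin (n i)) (Fin (n i)) ℝ) * b i

/-- The equivariant polynomial layer at a middle layer `1 < i < L`:
`E(U) = φ₁ · W^(i) + φ₂ · [W]^(i,0) · Ψ' · [W]^(L,i−1) + φ₃ · b^(i) · Ψ · [W]^(L,i−1)`. -/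
def Elayer (L : ℕ) (n : ℕ → ℕ) (i : ℕ) (φ1 φ2 φ3 : ℝ)
    (Ψ' : Matrix (Fin (n 0)) (Fin (n L)) ℝ) (Ψ : Matrix (Fin 1) (Fin (n L)) ℝ)
    (W : ∀ j : ℕ, Matrix (Fin (n j)) (Fin (n (j - 1))) ℝ)
    (b : ∀ j : ℕ, Matrix (Fin (n j)) (Fin 1) ℝ) :
    Matrix (Fin (n i)) (Fin (n (i - 1))) ℝ :=
  φ1 • W i + φ2 • (Wprod n W i 0 * Ψ' * Wprod n W L (i - 1))
    + φ3 • (b i * Ψ * Wprod n W L (i - 1))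

theorem Wprod_self (n : ℕ → ℕ) (W : ∀ i : ℕ, Matrix (Fin (n i)) (Fin (n (i - 1))) ℝ) (s : ℕ) :
    Wprod n W s s = 1 := by
  rw [Wprod, dif_neg (lt_irrefl s)]
  ext i j
  simp [Matrix.one_apply, Fin.ext_iff]

theorem Wprod_of_lt (n : ℕ → ℕ) (W : ∀ i : ℕ, Matrix (Fin (n i)) (Fin (n (i - 1))) ℝ)
    {s t : ℕ} (h : t < s) : Wprod n W s t = W s * Wprod n W (s - 1) t := by
  rw [Wprod, dif_pos h]

theorem Wprod_actW (n : ℕ → ℕ) (g : ∀ i : ℕ, GL (Fin (n i)) ℝ)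
    (W : ∀ i : ℕ, Matrix (Fin (n i)) (Fin (n (i - 1))) ℝ) {s t : ℕ} (h : t ≤ s) :
    Wprod n (actW n g W) s t =
      (g s : Matrix (Fin (n s)) (Fin (n s)) ℝ) * Wprod n W s t *
        (((g t)⁻¹ : GL (Fin (n t)) ℝ) : Matrix (Fin (n t)) (Fin (n t)) ℝ) := by
  induction s, h using Nat.le_induction with
  | base => rw [Wprod_self, Wprod_self, Matrix.mul_one, Units.mul_inv]
  | succ s h ih =>
    have ih' : Wprod n (actW n g W) (s + 1 - 1) t =
      (g (s + 1 - 1)).val * Wprod n W (s + 1 - 1) t * (g t)⁻¹.val := ih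
    rw [Wprod_of_lt n _ (Nat.lt_succ_of_le h), Wprod_of_lt n _ (Nat.lt_succ_of_le h), ih', actW]
    simp only [Matrix.mul_assoc]
    rw [← Matrix.mul_assoc (g (s + 1 - 1))⁻¹.val, Units.inv_mul, Matrix.one_mul]

/-- the layer `E` is `G`-equivariant at layer `i`:
`E(gU) = g^(i) · E(U) · (g^(i−1))⁻¹` for every `g ∈ G` and weight-space element `U`. -/
theorem Elayer_G_equivariant (L : ℕ) (n : ℕ → ℕ) (hn : ∀ j, 1 ≤ n j)
    (i : ℕ) (hi1 : 1 < i) (hiL : i < L)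
    (φ1 φ2 φ3 : ℝ)
    (Ψ' : Matrix (Fin (n 0)) (Fin (n L)) ℝ) (Ψ : Matrix (Fin 1) (Fin (n L)) ℝ)
    (g : ∀ j : ℕ, GL (Fin (n j)) ℝ) (hg : IsInG L n g)
    (W : ∀ j : ℕ, Matrix (Fin (n j)) (Fin (n (j - 1))) ℝ)
    (b : ∀ j : ℕ, Matrix (Fin (n j)) (Fin 1) ℝ) :
    Elayer L n i φ1 φ2 φ3 Ψ' Ψ (actW n g W) (actb n g b)
      = (g i : Matrix (Fin (n i)) (Fin (n i)) ℝ)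
          * Elayer L n i φ1 φ2 φ3 Ψ' Ψ W b
          * (((g (i - 1))⁻¹ : GL (Fin (n (i - 1))) ℝ)
              : Matrix (Fin (n (i - 1))) (Fin (n (i - 1))) ℝ) := by
  obtain ⟨hL, h0, -⟩ := hg
  have h0' : g 0 = 1 := Units.ext h0
  unfold Elayer
  rw [Wprod_actW n g W (Nat.zero_le i), Wprod_actW n g W (by omega : i - 1 ≤ L), hL, h0', inv_one,
    Units.val_one, Matrix.mul_one, Matrix.one_mul]
  simp only [actW, actb, Matrix.mul_add, Matrix.add_mul, Matrix.mul_smul, Matrix.smul_mul,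
    Matrix.mul_assoc]
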